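/- arXiv:2002.04901 — 2 statements merged into one kernel-verified Lean document; each statement's English description precedes it below -/
import Mathlib

section
/- Let 𝔞 be an ideal in a commutative ring A, A_k := A/𝔞^{k+1}, and M an A-module. The following are equivalent: (i) Tor_q^A(N, M) = 0 for every 𝔞-torsion A-module N and every q > 0; (ii) for every q > 0 and k ≥ 0, Tor_q^A(A_k, M) = 0 and A_k ⊗_A M is a flat A_k-module; (iii) for every q > 0, Tor_q^A(A_0, M) = 0 and A_0 ⊗_A M is a flat A_0-module. -/
open CategoryTheory

universe u

open TensorProduct

section Chase

variable {R N' N N'' W X Y Z : Type*} [CommRing R]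
  [AddCommGroup N'] [AddCommGroup N] [AddCommGroup N''] [AddCommGroup W]
  [AddCommGroup X] [AddCommGroup Y] [AddCommGroup Z]
  [Module R N'] [Module R N] [Module R N''] [Module R W] [Module R X] [Module R Y] [Module R Z]

theorem LinearMap.rTensor_lTensor_apply (f : N' →ₗ[R] N) (g : X →ₗ[R] Y) (t : N' ⊗[R] X) :
    f.rTensor Y (g.lTensor N' t) = g.lTensor N (f.rTensor X t) := by
  rw [← LinearMap.comp_apply, ← LinearMap.comp_apply, LinearMap.rTensor_comp_lTensor,
    LinearMap.lTensor_comp_rTensor]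

theorem LinearMap.lTensor_lTensor_apply_eq_zero {f : X →ₗ[R] Y} {g : Y →ₗ[R] Z}
    (hfg : g ∘ₗ f = 0) (t : N ⊗[R] X) : g.lTensor N (f.lTensor N t) = 0 := by
  rw [← LinearMap.comp_apply, ← LinearMap.lTensor_comp, hfg, LinearMap.lTensor_zero,
    LinearMap.zero_apply]

variable {i : N' →ₗ[R] N} {p : N →ₗ[R] N''}

/-- If `X → Y → Z` stays exact after tensoring with the outer terms of a short exact sequence, then
it stays exact after tensoring with the middle term. -/
theorem lTensor_exact_of_shortExact_middle (hi : Function.Injective i) (hip : Function.Exact i p)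
    (hp : Function.Surjective p) {f : X →ₗ[R] Y} {g : Y →ₗ[R] Z} [Module.Flat R Z]
    (hfg : g ∘ₗ f = 0)
    (h' : Function.Exact (f.lTensor N') (g.lTensor N'))
    (h'' : Function.Exact (f.lTensor N'') (g.lTensor N'')) :
    Function.Exact (f.lTensor N) (g.lTensor N) := by
  refine fun y ↦ ⟨fun hy ↦ ?_, ?_⟩
  · obtain ⟨x'', hx''⟩ := (h'' (p.rTensor Y y)).1 (by
      rw [← LinearMap.rTensor_lTensor_apply, hy, map_zero])
    obtain ⟨x, rfl⟩ := LinearMap.rTensor_surjective X hp x''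
    obtain ⟨y', hy'⟩ := (rTensor_exact Y hip hp (y - f.lTensor N x)).1 (by
      rw [map_sub, LinearMap.rTensor_lTensor_apply, hx'', sub_self])
    obtain ⟨x', rfl⟩ := (h' y').1 (by
      apply Module.Flat.rTensor_preserves_injective_linearMap (M := Z) i hi
      rw [LinearMap.rTensor_lTensor_apply, hy', map_sub, hy,
        LinearMap.lTensor_lTensor_apply_eq_zero hfg, sub_zero, map_zero])
    refine ⟨i.rTensor X x' + x, ?_⟩
    rw [map_add, ← LinearMap.rTensor_lTensor_apply, hy', sub_add_cancel]
  · rintro ⟨x, rfl⟩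
    exact LinearMap.lTensor_lTensor_apply_eq_zero hfg x

/-- Dimension shifting along a short exact sequence in the first tensor factor. -/
theorem lTensor_exact_of_shortExact_right (hip : Function.Exact i p)
    (hp : Function.Surjective p) {f : X →ₗ[R] Y} {g : Y →ₗ[R] Z} {h : Z →ₗ[R] W}
    (hfg : g ∘ₗ f = 0) (hgh : h ∘ₗ g = 0) (hW : Function.Injective (i.rTensor W))
    (h' : Function.Exact (g.lTensor N') (h.lTensor N'))
    (hN : Function.Exact (f.lTensor N) (g.lTensor N)) :
    Function.Exact (f.lTensor N'') (g.lTensor N'') := by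
  refine fun y'' ↦ ⟨fun hy'' ↦ ?_, ?_⟩
  · obtain ⟨y, rfl⟩ := LinearMap.rTensor_surjective Y hp y''
    obtain ⟨z', hz'⟩ := (rTensor_exact Z hip hp (g.lTensor N y)).1 (by
      rw [LinearMap.rTensor_lTensor_apply, hy''])
    obtain ⟨y', rfl⟩ := (h' z').1 (hW (by
      rw [LinearMap.rTensor_lTensor_apply, hz', LinearMap.lTensor_lTensor_apply_eq_zero hgh,
        map_zero]))
    obtain ⟨x, hx⟩ := (hN (y - i.rTensor Y y')).1 (by
      rw [map_sub, ← LinearMap.rTensor_lTensor_apply, hz', sub_self])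
    refine ⟨p.rTensor X x, ?_⟩
    rw [← LinearMap.rTensor_lTensor_apply, hx, map_sub,
      (rTensor_exact Y hip hp).apply_apply_eq_zero, sub_zero]
  · rintro ⟨x, rfl⟩
    exact LinearMap.lTensor_lTensor_apply_eq_zero hfg x

/-- If `N'' ⊗ X → N'' ⊗ Y → N'' ⊗ Z` is exact, where `Y → Z → W → 0` is a presentation with `Z`
flat, then `N' ⊗ W → N ⊗ W` is injective. -/
theorem rTensor_injective_of_lTensor_exact (hi : Function.Injective i) (hip : Function.Exact i p)
    (hp : Function.Surjective p) {f : X →ₗ[R] Y} {g : Y →ₗ[R] Z} {h : Z →ₗ[R] W}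
    [Module.Flat R Z] (hfg : g ∘ₗ f = 0) (hgh : Function.Exact g h) (hh : Function.Surjective h)
    (h'' : Function.Exact (f.lTensor N'') (g.lTensor N'')) :
    Function.Injective (i.rTensor W) := by
  rw [injective_iff_map_eq_zero]
  intro w hw
  obtain ⟨z, rfl⟩ := LinearMap.lTensor_surjective N' hh w
  obtain ⟨y, hy⟩ := (lTensor_exact N hgh hh (i.rTensor Z z)).1 (by
    rw [← LinearMap.rTensor_lTensor_apply, hw])
  obtain ⟨x'', hx''⟩ := (h'' (p.rTensor Y y)).1 (by
    rw [← LinearMap.rTensor_lTensor_apply, hy, (rTensor_exact Z hip hp).apply_apply_eq_zero])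
  obtain ⟨x, rfl⟩ := LinearMap.rTensor_surjective X hp x''
  obtain ⟨y', hy'⟩ := (rTensor_exact Y hip hp (y - f.lTensor N x)).1 (by
    rw [map_sub, LinearMap.rTensor_lTensor_apply, hx'', sub_self])
  have hz : g.lTensor N' y' = z := by
    apply Module.Flat.rTensor_preserves_injective_linearMap (M := Z) i hi
    rw [LinearMap.rTensor_lTensor_apply, hy', map_sub,
      LinearMap.lTensor_lTensor_apply_eq_zero hfg, sub_zero, hy]
  rw [← hz, (lTensor_exact N' hgh hh).apply_apply_eq_zero]

/-- Exactness of `N ⊗ X → N ⊗ Y → N ⊗ Z` can be checked on finitely generated submodules of `N`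
if `Z` is flat. -/
theorem lTensor_exact_of_forall_finite {f : X →ₗ[R] Y} {g : Y →ₗ[R] Z} [Module.Flat R Z]
    (hfg : g ∘ₗ f = 0)
    (H : ∀ S : Submodule R N, S.FG → Function.Exact (f.lTensor S) (g.lTensor S)) :
    Function.Exact (f.lTensor N) (g.lTensor N) := by
  refine fun y ↦ ⟨fun hy ↦ ?_, ?_⟩
  · obtain ⟨S, hS, hyS⟩ := TensorProduct.exists_finite_submodule_left_of_setFinite {y}
      (Set.finite_singleton y)
    obtain ⟨y', rfl⟩ := Set.singleton_subset_iff.1 hyS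
    obtain ⟨x', rfl⟩ := (H S (Module.Finite.iff_fg.1 hS) y').1 (by
      apply Module.Flat.rTensor_preserves_injective_linearMap (M := Z) S.subtype
        S.subtype_injective
      rw [LinearMap.rTensor_lTensor_apply, hy, map_zero])
    exact ⟨S.subtype.rTensor X x', (LinearMap.rTensor_lTensor_apply ..).symm⟩
  · rintro ⟨x, rfl⟩
    exact LinearMap.lTensor_lTensor_apply_eq_zero hfg x

end Chase

section BaseChange

variable {R S N' N X Y Z : Type*} [CommRing R] [CommRing S] [Algebra R S]
  [AddCommGroup N'] [AddCommGroup N] [AddCommGroup X] [AddCommGroup Y] [AddCommGroup Z]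
  [Module R N'] [Module S N'] [IsScalarTower R S N'] [Module R N] [Module S N]
  [IsScalarTower R S N] [Module R X] [Module R Y] [Module R Z]

theorem lTensor_exact_of_flat_of_lTensor_exact [Module.Flat S N] {f : X →ₗ[R] Y} {g : Y →ₗ[R] Z}
    (h : Function.Exact (f.lTensor S) (g.lTensor S)) :
    Function.Exact (f.lTensor N) (g.lTensor N) := by
  have hS : Function.Exact (f.baseChange S) (g.baseChange S) := h
  refine (Function.Exact.iff_of_ladder_addEquiv
    (f₁₂ := ((f.baseChange S).lTensor N).toAddMonoidHom)
    (f₂₃ := ((g.baseChange S).lTensor N).toAddMonoidHom)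
    (g₁₂ := (f.lTensor N).toAddMonoidHom) (g₂₃ := (g.lTensor N).toAddMonoidHom)
    (AlgebraTensorModule.cancelBaseChange R S S N X).toAddEquiv
    (AlgebraTensorModule.cancelBaseChange R S S N Y).toAddEquiv
    (AlgebraTensorModule.cancelBaseChange R S S N Z).toAddEquiv ?_ ?_).2
    (Module.Flat.lTensor_exact N hS)
  · exact congr_arg LinearMap.toAddMonoidHom
      (AlgebraTensorModule.lTensor_comp_cancelBaseChange R S S f)
  · exact congr_arg LinearMap.toAddMonoidHom
      (AlgebraTensorModule.lTensor_comp_cancelBaseChange R S S g)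

theorem rTensor_baseChange_injective_iff (i : N' →ₗ[S] N) :
    Function.Injective (i.rTensor (S ⊗[R] X)) ↔
      Function.Injective ((i.restrictScalars R).rTensor X) := by
  have h : (i.restrictScalars R).rTensor X ∘ AlgebraTensorModule.cancelBaseChange R S S N' X =
      AlgebraTensorModule.cancelBaseChange R S S N X ∘ i.rTensor (S ⊗[R] X) := by
    have : AlgebraTensorModule.rTensor R X i ∘ₗ
        (AlgebraTensorModule.cancelBaseChange R S S N' X).toLinearMap =
        (AlgebraTensorModule.cancelBaseChange R S S N X).toLinearMap ∘ₗ
          i.rTensor (S ⊗[R] X) := by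
      ext; simp
    exact congr_arg DFunLike.coe this
  rw [← EquivLike.injective_comp (AlgebraTensorModule.cancelBaseChange R S S N' X), h,
    EquivLike.comp_injective]

theorem exists_flat_scalarTower_surjective (R : Type*) {S N : Type u} [CommRing R] [CommRing S]
    [Algebra R S] [AddCommGroup N] [Module S N] :
    ∃ (F : Type u) (_ : AddCommGroup F) (_ : Module R F) (_ : Module S F)
      (_ : IsScalarTower R S F) (_ : Module.Flat S F) (p : F →ₗ[S] N), Function.Surjective p :=
  ⟨N →₀ S, inferInstance, inferInstance, inferInstance, inferInstance, inferInstance, _,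
    Finsupp.linearCombination_id_surjective S N⟩

end BaseChange

namespace CategoryTheory.ProjectiveResolution

variable {A : Type u} [CommRing A] {M : ModuleCat.{u} A} (P : ProjectiveResolution M)

theorem isZero_Tor_succ_iff (N : ModuleCat.{u} A) (q : ℕ) :
    Limits.IsZero (((Tor (ModuleCat.{u} A) (q + 1)).obj N).obj M) ↔
      Function.Exact ((P.complex.d (q + 2) (q + 1)).hom.lTensor N)
        ((P.complex.d (q + 1) q).hom.lTensor N) := by
  rw [Tor_obj, (P.isoLeftDerivedObj _ (q + 1)).isZero_iff,
    HomologicalComplex.homologyFunctor_obj, ← HomologicalComplex.exactAt_iff_isZero_homology,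
    HomologicalComplex.exactAt_iff' _ (q + 2) (q + 1) q (by simp only [ChainComplex.prev]; rfl)
    (by simp), ShortComplex.ShortExact.moduleCat_exact_iff_function_exact]
  rfl

/-- The augmentation of a projective resolution of modules, as a linear map. -/
noncomputable def augmentation : P.complex.X 0 →ₗ[A] M := (P.π.f 0).hom

theorem exact_augmentation : Function.Exact (P.complex.d 1 0).hom P.augmentation :=
  (ShortComplex.ShortExact.moduleCat_exact_iff_function_exact _).1 P.exact₀

theorem augmentation_surjective : Function.Surjective P.augmentation :=
  (ModuleCat.epi_iff_surjective (P.π.f 0)).1 inferInstance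

theorem d_hom_comp_d_hom (i j k : ℕ) :
    (P.complex.d j k).hom ∘ₗ (P.complex.d i j).hom = 0 := by
  rw [← ModuleCat.hom_comp, P.complex.d_comp_d, ModuleCat.hom_zero]

instance flat_X (n : ℕ) : Module.Flat A (P.complex.X n) :=
  have : Module.Projective A (P.complex.X n) :=
    (IsProjective.iff_projective (P.complex.X n)).2 (P.projective n)
  inferInstance

/-- If `Tor_q(B, M) = 0` for all `q > 0` and `B ⊗ M` is flat over the `A`-algebra `B`, then
`Tor_q(N, M) = 0` for all `q > 0` and all `B`-modules `N`. -/
theorem lTensor_exact_of_flat_baseChange {B : Type u} [CommRing B] [Algebra A B]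
    (hB : ∀ q, Function.Exact ((P.complex.d (q + 2) (q + 1)).hom.lTensor B)
      ((P.complex.d (q + 1) q).hom.lTensor B))
    [Module.Flat B (B ⊗[A] M)] (q : ℕ) (N : Type u) [AddCommGroup N] [Module A N] [Module B N]
    [IsScalarTower A B N] :
    Function.Exact ((P.complex.d (q + 2) (q + 1)).hom.lTensor N)
      ((P.complex.d (q + 1) q).hom.lTensor N) := by
  induction q generalizing N with
  | zero =>
    obtain ⟨F, _, _, _, _, _, p, hp⟩ := exists_flat_scalarTower_surjective A (S := B) (N := N)
    have hW : Function.Injective (((LinearMap.ker p).subtype.restrictScalars A).rTensor M) :=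
      (rTensor_baseChange_injective_iff _).1
        (Module.Flat.rTensor_preserves_injective_linearMap _ Subtype.val_injective)
    exact lTensor_exact_of_shortExact_right (p := p.restrictScalars A)
      (LinearMap.exact_subtype_ker_map p) hp (P.d_hom_comp_d_hom 2 1 0)
      P.exact_augmentation.linearMap_comp_eq_zero hW
      (lTensor_exact _ P.exact_augmentation P.augmentation_surjective)
      (lTensor_exact_of_flat_of_lTensor_exact (hB 0))
  | succ q ih =>
    obtain ⟨F, _, _, _, _, _, p, hp⟩ := exists_flat_scalarTower_surjective A (S := B) (N := N)
    have hW : Function.Injective (((LinearMap.ker p).subtype.restrictScalars A).rTensor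
        (P.complex.X q)) :=
      Module.Flat.rTensor_preserves_injective_linearMap _ Subtype.val_injective
    exact lTensor_exact_of_shortExact_right (p := p.restrictScalars A)
      (LinearMap.exact_subtype_ker_map p) hp (P.d_hom_comp_d_hom _ _ _)
      (P.d_hom_comp_d_hom _ _ _) hW (ih (LinearMap.ker p))
      (lTensor_exact_of_flat_of_lTensor_exact (hB (q + 1)))

/-- If `Tor_q(N, M) = 0` for all `q > 0` and all `A ⧸ I`-modules `N`, then the same holds for all
`N` killed by a power of `I`. -/
theorem lTensor_exact_of_isTorsionBySet_pow (I : Ideal A) (q : ℕ)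
    (H : ∀ (N : Type u) [AddCommGroup N] [Module A N], Module.IsTorsionBySet A N I →
      Function.Exact ((P.complex.d (q + 2) (q + 1)).hom.lTensor N)
        ((P.complex.d (q + 1) q).hom.lTensor N)) (k : ℕ) (N : Type u) [AddCommGroup N]
    [Module A N] (hN : Module.IsTorsionBySet A N (I ^ k : Ideal A)) :
    Function.Exact ((P.complex.d (q + 2) (q + 1)).hom.lTensor N)
      ((P.complex.d (q + 1) q).hom.lTensor N) := by
  induction k generalizing N with
  | zero =>
    refine H N fun x a ↦ ?_
    have h : (1 : A) • x = 0 := @hN x ⟨1, by simp⟩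
    rw [one_smul] at h
    rw [h, smul_zero]
  | succ k ih =>
    let N' : Submodule A N := I • ⊤
    refine lTensor_exact_of_shortExact_middle N'.subtype_injective (LinearMap.exact_subtype_mkQ N')
      N'.mkQ_surjective (P.d_hom_comp_d_hom _ _ _) (ih N' fun x a ↦ Subtype.ext ?_)
      (H _ (Module.isTorsionBySet_quotient_ideal_smul N I))
    have hx : (a : A) • (x : N) ∈ (I ^ k : Ideal A) • (I • ⊤ : Submodule A N) :=
      Submodule.smul_mem_smul a.2 x.2
    rw [← mul_smul, ← pow_succ] at hx
    have hbot : (I ^ (k + 1) : Ideal A) • (⊤ : Submodule A N) = ⊥ := by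
      rw [eq_bot_iff, Submodule.smul_le]
      exact fun r hr n _ ↦ @hN n ⟨r, hr⟩
    rw [hbot] at hx
    exact hx

theorem lTensor_exact_of_isTorsion (I : Ideal A) (q : ℕ)
    (H : ∀ (N : Type u) [AddCommGroup N] [Module A N], Module.IsTorsionBySet A N I →
      Function.Exact ((P.complex.d (q + 2) (q + 1)).hom.lTensor N)
        ((P.complex.d (q + 1) q).hom.lTensor N)) (N : Type u) [AddCommGroup N]
    [Module A N] (hN : ∀ x : N, ∃ k : ℕ, ∀ r ∈ I ^ k, r • x = 0) :
    Function.Exact ((P.complex.d (q + 2) (q + 1)).hom.lTensor N)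
      ((P.complex.d (q + 1) q).hom.lTensor N) := by
  refine lTensor_exact_of_forall_finite (P.d_hom_comp_d_hom _ _ _) fun S hS ↦ ?_
  obtain ⟨s, rfl⟩ := hS
  choose k hk using hN
  refine P.lTensor_exact_of_isTorsionBySet_pow I q H (s.sup k) _ fun x a ↦ Subtype.ext ?_
  have hle : Submodule.span A (s : Set N) ≤ LinearMap.ker (LinearMap.lsmul A N a) :=
    Submodule.span_le.2 fun y hy ↦
      hk y a (Ideal.pow_le_pow_right (Finset.le_sup (f := k) hy) a.2)
  exact hle x.2

/-- If `Tor₁(N, M) = 0` for all modules `N` over the `A`-algebra `B`, then `B ⊗ M` is flat. -/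
theorem flat_baseChange_of_lTensor_exact {B : Type u} [CommRing B] [Algebra A B]
    (H : ∀ (N : Type u) [AddCommGroup N] [Module A N] [Module B N] [IsScalarTower A B N],
      Function.Exact ((P.complex.d 2 1).hom.lTensor N) ((P.complex.d 1 0).hom.lTensor N)) :
    Module.Flat B (B ⊗[A] M) := by
  rw [Module.Flat.iff_rTensor_injective']
  intro I
  rw [rTensor_baseChange_injective_iff]
  exact rTensor_injective_of_lTensor_exact (p := I.mkQ.restrictScalars A) Subtype.val_injective
    (LinearMap.exact_subtype_mkQ I) I.mkQ_surjective (P.d_hom_comp_d_hom 2 1 0)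
    P.exact_augmentation P.augmentation_surjective (H (B ⧸ I))

end CategoryTheory.ProjectiveResolution

/-- Characterization of `𝔞`-adically flat modules (`Tor_q(N, M) = 0` for all
`𝔞`-torsion `N` and `q > 0`): with `A_k := A/𝔞^(k+1)`, the following are
equivalent: (i) `M` is `𝔞`-adically flat; (ii) for all `q > 0` and `k ≥ 0`,
`Tor_q^A(A_k, M) = 0` and `A_k ⊗_A M` is flat over `A_k`; (iii) `Tor_q^A(A_0, M) = 0`
for all `q > 0` and `A_0 ⊗_A M` is flat over `A_0`. -/
theorem adically_flat_tfae {A : Type u} [CommRing A] (𝔞 : Ideal A)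
    (M : Type u) [AddCommGroup M] [Module A M] :
    List.TFAE [
      -- (i) `M` is `𝔞`-adically flat
      ∀ (N : Type u) [AddCommGroup N] [Module A N],
        (∀ x : N, ∃ k : ℕ, ∀ r ∈ 𝔞 ^ k, r • x = 0) →
        ∀ q : ℕ, 0 < q →
          Limits.IsZero (((Tor (ModuleCat.{u} A) q).obj
            (ModuleCat.of A N)).obj (ModuleCat.of A M)),
      -- (ii)
      ∀ (q : ℕ), 0 < q → ∀ (k : ℕ),
        Limits.IsZero (((Tor (ModuleCat.{u} A) q).obj
          (ModuleCat.of A (A ⧸ 𝔞 ^ (k + 1)))).obj (ModuleCat.of A M)) ∧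
        Module.Flat (A ⧸ 𝔞 ^ (k + 1)) (TensorProduct A (A ⧸ 𝔞 ^ (k + 1)) M),
      -- (iii)
      (∀ (q : ℕ), 0 < q →
        Limits.IsZero (((Tor (ModuleCat.{u} A) q).obj
          (ModuleCat.of A (A ⧸ 𝔞 ^ (0 + 1)))).obj (ModuleCat.of A M))) ∧
        Module.Flat (A ⧸ 𝔞 ^ (0 + 1)) (TensorProduct A (A ⧸ 𝔞 ^ (0 + 1)) M)] := by
  obtain ⟨⟨P⟩⟩ := HasProjectiveResolutions.out (ModuleCat.of A M)
  tfae_have 1 → 2 := by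
    intro h q hq k
    refine ⟨h _ (fun x ↦ ⟨k + 1, fun r hr ↦ ?_⟩) q hq,
      P.flat_baseChange_of_lTensor_exact fun N _ _ _ _ ↦
        (P.isZero_Tor_succ_iff (ModuleCat.of A N) 0).1
          (h N (fun x ↦ ⟨k + 1, fun r hr ↦ ?_⟩) 1 one_pos)⟩
    · rw [Algebra.smul_def, Ideal.Quotient.algebraMap_eq, Ideal.Quotient.eq_zero_iff_mem.2 hr,
        zero_mul]
    · rw [← algebraMap_smul (A ⧸ 𝔞 ^ (k + 1)) r x, Ideal.Quotient.algebraMap_eq,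
        Ideal.Quotient.eq_zero_iff_mem.2 hr, zero_smul]
  tfae_have 2 → 3 := fun h ↦ ⟨fun q hq ↦ (h q hq 0).1, (h 1 one_pos 0).2⟩
  tfae_have 3 → 1 := by
    rintro ⟨h, hflat⟩ N _ _ hN (_ | q) hq
    · exact absurd hq (lt_irrefl 0)
    rw [P.isZero_Tor_succ_iff]
    refine P.lTensor_exact_of_isTorsion 𝔞 q (fun N' _ _ hN' ↦ ?_) N hN
    have hN'' : Module.IsTorsionBySet A N' (𝔞 ^ (0 + 1) : Ideal A) := by
      rwa [zero_add, pow_one]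
    let _ := hN''.module
    have : Module.Flat (A ⧸ 𝔞 ^ (0 + 1)) ((A ⧸ 𝔞 ^ (0 + 1)) ⊗[A] (ModuleCat.of A M)) := hflat
    exact P.lTensor_exact_of_flat_baseChange (B := A ⧸ 𝔞 ^ (0 + 1))
      (fun q ↦ (P.isZero_Tor_succ_iff (ModuleCat.of A _) q).1 (h (q + 1) q.succ_pos)) q N'
  tfae_finish
end

section
/- If A is a noetherian commutative ring, 𝔞 ⊆ A an ideal, and M a flat A-module, then the 𝔞-adic completion M̂ = lim_{←k} M/𝔞^k M is a flat A-module. -/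
open TensorProduct

/-- The Artin–Rees property of a linear map `f`: up to a constant shift, the `I`-adic topology on
the range of `f` induced by the codomain is finer than the quotient of the `I`-adic topology of the
domain. -/
def LinearMap.IsArtinRees {R X Y : Type*} [CommRing R] [AddCommGroup X] [Module R X]
    [AddCommGroup Y] [Module R Y] (I : Ideal R) (f : X →ₗ[R] Y) : Prop :=
  ∃ c : ℕ, ∀ n : ℕ, (I ^ (n + c) • ⊤ : Submodule R Y) ⊓ LinearMap.range f ≤
    Submodule.map f (I ^ n • ⊤ : Submodule R X)

namespace LinearMap

variable {R X Y : Type*} [CommRing R] [AddCommGroup X] [Module R X] [AddCommGroup Y] [Module R Y]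
  (I : Ideal R)

lemma isArtinRees_of_finite [IsNoetherianRing R] [Module.Finite R Y] (f : X →ₗ[R] Y) :
    f.IsArtinRees I := by
  obtain ⟨c, hc⟩ := Ideal.exists_pow_inf_eq_pow_smul I (range f)
  refine ⟨c, fun n => ?_⟩
  rw [hc (n + c) (Nat.le_add_left c n), Nat.add_sub_cancel, Submodule.map_smul'',
    Submodule.map_top]
  exact smul_mono_right _ inf_le_right

lemma IsArtinRees.rTensor {I : Ideal R} {f : X →ₗ[R] Y} (hf : f.IsArtinRees I)
    (M : Type*) [AddCommGroup M] [Module R M] [Module.Flat R M] :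
    (f.rTensor M).IsArtinRees I := by
  obtain ⟨c, hc⟩ := hf
  refine ⟨c, fun n => ?_⟩
  rintro _ ⟨hy, x, rfl⟩
  let q := (I ^ (n + c) • ⊤ : Submodule R Y).mkQ
  have hq : q.rTensor M (f.rTensor M x) = 0 := by
    suffices (I ^ (n + c) • ⊤ : Submodule R (Y ⊗[R] M)) ≤ ker (q.rTensor M) from this hy
    refine Submodule.smul_le.mpr fun r hr t ht => ?_
    clear ht
    rw [mem_ker]
    induction t with
    | zero => simp
    | add s t hs ht => rw [smul_add, map_add, hs, ht, add_zero]
    | tmul y m =>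
      have h : q (r • y) = 0 := by
        rw [← mem_ker, Submodule.ker_mkQ]
        exact Submodule.smul_mem_smul hr Submodule.mem_top
      rw [TensorProduct.smul_tmul', rTensor_tmul, h, TensorProduct.zero_tmul]
  rw [← rTensor_comp_apply] at hq
  obtain ⟨t, rfl⟩ := (Module.Flat.rTensor_exact M (q ∘ₗ f).exact_subtype_ker_map x).mp hq
  clear hy hq
  induction t with
  | zero => simp
  | add s t hs ht => simpa only [map_add] using add_mem hs ht
  | tmul l m =>
    have hl : f l ∈ (I ^ (n + c) • ⊤ : Submodule R Y) :=
      (Submodule.Quotient.mk_eq_zero _).mp l.2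
    obtain ⟨v, hv, hvl⟩ := hc n ⟨hl, l, rfl⟩
    refine ⟨v ⊗ₜ m, ?_, by simp [hvl]⟩
    have h : Submodule.map ((TensorProduct.mk R X M).flip m) (I ^ n • ⊤) ≤ I ^ n • ⊤ := by
      rw [Submodule.map_smul'']
      exact smul_mono_right _ le_top
    exact h ⟨v, hv, rfl⟩

end LinearMap

namespace AdicCompletion

variable {R : Type*} [CommRing R] (I : Ideal R)
  {X Y Z : Type*} [AddCommGroup X] [Module R X] [AddCommGroup Y] [Module R Y]
  [AddCommGroup Z] [Module R Z]

lemma map_sum_apply {ι : Type*} (s : Finset ι) (f : ι → X →ₗ[R] Y) (x : AdicCompletion I X) :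
    map I (∑ i ∈ s, f i) x = ∑ i ∈ s, map I (f i) x := by
  induction x using induction_on with | h a
  ext n
  simp

lemma map_smul_apply (r : R) (f : X →ₗ[R] Y) (x : AdicCompletion I X) :
    map I (r • f) x = r • map I f x := by
  induction x using induction_on with | h a
  ext n
  simp [val_smul_apply]

lemma map_exact_of_isArtinRees {I : Ideal R} {f : X →ₗ[R] Y} {g : Y →ₗ[R] Z}
    (hfg : Function.Exact f g) (hf : f.IsArtinRees I) (hg : g.IsArtinRees I) :
    Function.Exact (map I f) (map I g) := by
  refine LinearMap.exact_of_comp_eq_zero_of_ker_le_range ?_ fun y hy => ?_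
  · rw [map_comp, hfg.linearMap_comp_eq_zero, map_zero]
  induction y using induction_on with | h b
  obtain ⟨c, hc⟩ := hf
  obtain ⟨d, hd⟩ := hg
  have hb (n : ℕ) : g (b n) ∈ (I ^ n • ⊤ : Submodule R Z) := by
    simpa using congrArg (fun x => x.val n) hy
  have approx (n : ℕ) : ∃ x : X, f x - b (n + c + d) ∈ (I ^ (n + c) • ⊤ : Submodule R Y) := by
    obtain ⟨z, hz, hgz⟩ := hd (n + c) ⟨hb (n + c + d), b (n + c + d), rfl⟩
    obtain ⟨x, hx⟩ := (hfg (b (n + c + d) - z)).mp (by rw [map_sub, hgz, sub_self])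
    refine ⟨x, ?_⟩
    rw [hx, sub_sub_cancel_left]
    exact neg_mem hz
  choose x hx using approx
  have step (n : ℕ) : ∃ w ∈ (I ^ n • ⊤ : Submodule R X), f w = f (x (n + 1) - x n) := by
    refine hc n ⟨?_, x (n + 1) - x n, rfl⟩
    have h₁ := Submodule.smul_mono_left (N := (⊤ : Submodule R Y))
      (Ideal.pow_le_pow_right (I := I) (show n + c ≤ n + 1 + c by lia)) (hx (n + 1))
    have h₂ : b (n + 1 + c + d) - b (n + c + d) ∈ (I ^ (n + c) • ⊤ : Submodule R Y) := by
      have h := AdicCauchySequence.mk_eq_mk (show n + c + d ≤ n + 1 + c + d by lia) b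
      rw [Submodule.Quotient.eq] at h
      exact Submodule.smul_mono_left (Ideal.pow_le_pow_right (by lia)) h
    have h := sub_mem (add_mem h₁ h₂) (hx n)
    rw [map_sub]
    rwa [sub_add_sub_cancel, sub_sub_sub_cancel_right] at h
  choose w hw hfw using step
  let a (n : ℕ) : X := x 0 + ∑ i ∈ Finset.range n, w i
  have hfa (n : ℕ) : f (a n) = f (x n) := by
    simp only [a, map_add, map_sum, hfw, map_sub]
    rw [Finset.sum_range_sub (fun n => f (x n)), add_sub_cancel]
  refine ⟨mk I X (AdicCauchySequence.mk I X a fun n => ?_), ?_⟩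
  · rw [SModEq.comm, SModEq.sub_mem]
    simpa [a, Finset.sum_range_succ] using hw n
  · ext n
    have h : Submodule.Quotient.mk (p := (I ^ n • ⊤ : Submodule R Y)) (f (a n)) =
        Submodule.Quotient.mk (p := (I ^ n • ⊤ : Submodule R Y)) (b (n + c + d)) := by
      rw [Submodule.Quotient.eq, hfa]
      exact Submodule.smul_mono_left (Ideal.pow_le_pow_right (by lia)) (hx n)
    simp [h, AdicCauchySequence.mk_eq_mk (show n ≤ n + c + d by lia)]

end AdicCompletion

/-- If `A` is a noetherian commutative ring, `𝔞 ⊆ A` an ideal and `M` a flat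
`A`-module, then the `𝔞`-adic completion `M̂ = lim_k M/𝔞^k M` is a flat
`A`-module. -/
theorem adicCompletion_flat_of_flat {A : Type*} [CommRing A] [IsNoetherianRing A]
    (𝔞 : Ideal A) (M : Type*) [AddCommGroup M] [Module A M] [Module.Flat A M] :
    Module.Flat A (AdicCompletion 𝔞 M) := by
  refine Module.Flat.of_forall_isTrivialRelation fun {l f x} hfx => ?_
  let φ : (Fin l → A) →ₗ[A] A := Fintype.linearCombination A f
  obtain ⟨k, g₀, hg₀⟩ := Module.Finite.exists_fin' A (LinearMap.ker φ)
  let g : (Fin k → A) →ₗ[A] (Fin l → A) := (LinearMap.ker φ).subtype ∘ₗ g₀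
  have hφg (v : Fin k → A) : φ (g v) = 0 := (g₀ v).2
  have hgφ : Function.Exact g φ := fun v =>
    ⟨fun hv => (hg₀ ⟨v, hv⟩).imp fun u hu => congrArg Subtype.val hu, by
      rintro ⟨u, rfl⟩; exact hφg u⟩
  have hexact := AdicCompletion.map_exact_of_isArtinRees (Module.Flat.rTensor_exact M hgφ)
    ((g.isArtinRees_of_finite 𝔞).rTensor M) ((φ.isArtinRees_of_finite 𝔞).rTensor M)
  let s (n : ℕ) (i : Fin n) : M →ₗ[A] (Fin n → A) ⊗[A] M :=
    TensorProduct.mk A (Fin n → A) M (Pi.single i 1)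
  let p (n : ℕ) (i : Fin n) : (Fin n → A) ⊗[A] M →ₗ[A] M :=
    (TensorProduct.lid A M).toLinearMap ∘ₗ (LinearMap.proj i).rTensor M
  have hps (i i' : Fin l) : p l i ∘ₗ s l i' = if i = i' then LinearMap.id else 0 := by
    ext m
    by_cases h : i = i' <;> simp [p, s, h]
  have hsp : ∑ j, s k j ∘ₗ p k j = LinearMap.id := by
    ext j m
    simp [p, s, Pi.single_apply, TensorProduct.tmul_ite]
  have hpgs (i : Fin l) (j : Fin k) :
      p l i ∘ₗ g.rTensor M ∘ₗ s k j = g (Pi.single j 1) i • LinearMap.id := by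
    ext m
    simp [p, s]
  have hφs (i : Fin l) : φ.rTensor M ∘ₗ s l i = f i • TensorProduct.mk A A M 1 := by
    ext m
    simp [φ, s, TensorProduct.smul_tmul']
  let z : AdicCompletion 𝔞 ((Fin l → A) ⊗[A] M) := ∑ i, AdicCompletion.map 𝔞 (s l i) (x i)
  have hz : AdicCompletion.map 𝔞 (φ.rTensor M) z = 0 := by
    have h : AdicCompletion.map 𝔞 (TensorProduct.mk A A M 1) (∑ i, f i • x i) = 0 := by
      rw [hfx, map_zero]
    simpa [z, AdicCompletion.map_comp_apply, hφs, AdicCompletion.map_smul_apply] using h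
  obtain ⟨w, hw⟩ := (hexact z).mp hz
  refine ⟨k, fun i j => g (Pi.single j 1) i, fun j => AdicCompletion.map 𝔞 (p k j) w,
    fun i => ?_, fun j => ?_⟩
  · have hw' : w = ∑ j, AdicCompletion.map 𝔞 (s k j) (AdicCompletion.map 𝔞 (p k j) w) := by
      simp [AdicCompletion.map_comp_apply, ← AdicCompletion.map_sum_apply, hsp]
    calc
      x i = AdicCompletion.map 𝔞 (p l i) z := by
        simp only [z, map_sum, AdicCompletion.map_comp_apply, hps]
        rw [Finset.sum_eq_single i (fun j _ hj => by simp [hj.symm]) (by simp)]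
        simp
      _ = _ := by
        rw [← hw, congrArg (AdicCompletion.map 𝔞 (g.rTensor M)) hw', map_sum, map_sum]
        refine Finset.sum_congr rfl fun j _ => ?_
        rw [AdicCompletion.map_comp_apply 𝔞 (s k j), AdicCompletion.map_comp_apply 𝔞 _ (p l i),
          hpgs, AdicCompletion.map_smul_apply, AdicCompletion.map_id]
        rfl
  · simpa [φ, Fintype.linearCombination_apply, mul_comm] using hφg (Pi.single j 1)
end
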